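/- arXiv:0909.5419 — 5 statements merged into one kernel-verified Lean document; each statement's English description precedes it below -/
import Mathlib

section
/- Let A be a commutative unital algebra over ℝ and Δ : A → A an ℝ-linear map. Define {a,b}_Δ := Δ(ab) − aΔ(b) − Δ(a)b + abΔ(1). Then {·,·}_Δ is a derivation in each argument (i.e. {a,bc} = {a,b}c + b{a,c} for all a,b,c ∈ A) if and only if Δ has algebraic order at most two, i.e. for all a,b,c ∈ A the iterated commutator [[[Δ, L_a], L_b], L_c] vanishes as an operator on A, where L_x denotes the multiplication operator y ↦ xy. -/
/-- For a commutative unital `ℝ`-algebra `A` and an `ℝ`-linear map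
`Δ : A → A`, the bracket `{a,b}_Δ := Δ(ab) − aΔ(b) − Δ(a)b + abΔ(1)` is a derivation in
each argument if and only if `Δ` has algebraic order at most two, i.e. the iterated
commutator `[[[Δ, L_a], L_b], L_c]` vanishes as an operator on `A` for all `a, b, c`,
where `L_x` is the multiplication operator `y ↦ x * y`. -/
theorem bracket_is_biderivation_iff_order_le_two
    {A : Type*} [CommRing A] [Algebra ℝ A] (Δ : A →ₗ[ℝ] A) :
    (∀ a b c : A,
        Δ (a * (b * c)) - a * Δ (b * c) - Δ a * (b * c) + a * (b * c) * Δ 1 =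
          (Δ (a * b) - a * Δ b - Δ a * b + a * b * Δ 1) * c +
            b * (Δ (a * c) - a * Δ c - Δ a * c + a * c * Δ 1)) ↔
      (∀ a b c : A,
        ⁅⁅⁅(Δ : Module.End ℝ A), (LinearMap.mulLeft ℝ a : Module.End ℝ A)⁆,
            (LinearMap.mulLeft ℝ b : Module.End ℝ A)⁆,
          (LinearMap.mulLeft ℝ c : Module.End ℝ A)⁆ = 0) := by
  constructor
  · intro h a b c
    ext x
    have h₁ := h a b (c * x)
    have h₂ := h a b x
    simp only [Ring.lie_def, LinearMap.sub_apply, Module.End.mul_apply,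
      LinearMap.mulLeft_apply, LinearMap.zero_apply]
    linear_combination h₁ - c * h₂
  · intro h a b c
    have h₁ := LinearMap.congr_fun (h a b c) 1
    simp only [Ring.lie_def, LinearMap.sub_apply, Module.End.mul_apply,
      LinearMap.mulLeft_apply, LinearMap.zero_apply, mul_one] at h₁
    linear_combination h₁
end

section
/- Let A be a commutative unital algebra over ℝ equipped with a symmetric ℝ-bilinear form ⟨·,·⟩ : A × A → ℝ that is invariant (⟨ab,c⟩ = ⟨a,bc⟩ for all a,b,c ∈ A) and nondegenerate. Let Δ : A → A be ℝ-linear such that the bracket {a,b}_Δ := Δ(ab) − aΔ(b) − Δ(a)b + abΔ(1) is a derivation in each argument, and suppose Δ* : A → A is an adjoint of Δ, i.e. ⟨Δ(a), b⟩ = ⟨a, Δ*(b)⟩ for all a,b. Then Δ* generates the same bracket: Δ*(ab) − aΔ*(b) − Δ*(a)b + abΔ*(1) = {a,b}_Δ for all a,b ∈ A. -/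
/-- Over a commutative unital `ℝ`-algebra `A` with an invariant
nondegenerate symmetric scalar product, if an `ℝ`-linear operator `Δ` has a bracket
`{a,b}_Δ = Δ(ab) − aΔ(b) − Δ(a)b + abΔ(1)` that is a derivation in each argument,
then any adjoint `Δ*` of `Δ` generates the same bracket. -/
theorem adjoint_generates_same_bracket
    {A : Type*} [CommRing A] [Algebra ℝ A] (B : A →ₗ[ℝ] A →ₗ[ℝ] ℝ)
    (hBsymm : ∀ a b : A, B a b = B b a)
    (hBinv : ∀ a b c : A, B (a * b) c = B a (b * c))
    (hBnd : ∀ a : A, (∀ b : A, B a b = 0) → a = 0)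
    (Δ Δstar : A →ₗ[ℝ] A)
    (hder : ∀ a b c : A,
      Δ (a * (b * c)) - a * Δ (b * c) - Δ a * (b * c) + a * (b * c) * Δ 1 =
        (Δ (a * b) - a * Δ b - Δ a * b + a * b * Δ 1) * c +
          b * (Δ (a * c) - a * Δ c - Δ a * c + a * c * Δ 1))
    (hadj : ∀ a b : A, B (Δ a) b = B a (Δstar b)) :
    ∀ a b : A,
      Δstar (a * b) - a * Δstar b - Δstar a * b + a * b * Δstar 1 =
        Δ (a * b) - a * Δ b - Δ a * b + a * b * Δ 1 := by
  intro a b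
  have form_eq : ∀ x y : A, B x y = B 1 (x * y) := fun x y => by
    rw [← hBinv, one_mul]
  have adj_eq : ∀ x y z : A, B 1 (x * Δstar y * z) = B 1 (y * Δ (x * z)) := fun x y z => by
    rw [mul_right_comm, ← form_eq, ← hadj, hBsymm, form_eq]
  rw [← sub_eq_zero]
  apply hBnd
  intro c
  have expand : (Δstar (a * b) - a * Δstar b - Δstar a * b + a * b * Δstar 1 -
      (Δ (a * b) - a * Δ b - Δ a * b + a * b * Δ 1)) * c =
      1 * Δstar (a * b) * c - a * Δstar b * c - b * Δstar a * c + a * b * Δstar 1 * c -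
        (Δ (a * b) - a * Δ b - Δ a * b + a * b * Δ 1) * c := by
    ring
  rw [form_eq, expand]
  simp only [map_sub (B 1), map_add (B 1), adj_eq]
  rw [← map_sub, ← map_sub, ← map_add, ← map_sub]
  have vanish : a * b * Δ (1 * c) - b * Δ (a * c) - a * Δ (b * c) + 1 * Δ (a * b * c) -
      (Δ (a * b) - a * Δ b - Δ a * b + a * b * Δ 1) * c = 0 := by
    rw [one_mul, one_mul, mul_assoc a b c]
    linear_combination hder a b c
  rw [vanish, map_zero]
end

section
/- Let A be a commutative unital algebra over ℝ equipped with a symmetric ℝ-bilinear form ⟨·,·⟩ : A × A → ℝ that is invariant (⟨ab,c⟩ = ⟨a,bc⟩ for all a,b,c ∈ A) and nondegenerate. If X : A → A is a derivation (X(ab) = X(a)b + aX(b)) that is self-adjoint with respect to ⟨·,·⟩ (⟨X(a),b⟩ = ⟨a,X(b)⟩ for all a,b ∈ A), then X = 0. -/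
/-- Over a commutative unital `ℝ`-algebra `A` with an invariant
nondegenerate symmetric scalar product, any self-adjoint derivation `X : A → A`
vanishes identically. -/
theorem selfadjoint_derivation_is_zero
    {A : Type*} [CommRing A] [Algebra ℝ A] (B : A →ₗ[ℝ] A →ₗ[ℝ] ℝ)
    (hBsymm : ∀ a b : A, B a b = B b a)
    (hBinv : ∀ a b c : A, B (a * b) c = B a (b * c))
    (hBnd : ∀ a : A, (∀ b : A, B a b = 0) → a = 0)
    (X : A → A)
    (hXder : ∀ a b : A, X (a * b) = X a * b + a * X b)
    (hXsa : ∀ a b : A, B (X a) b = B a (X b)) :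
    ∀ a : A, X a = 0 := by
  have h_one : X 1 = 0 := by simpa using hXder 1 1
  refine fun a => hBnd _ fun b => ?_
  have h_zero : B (X (a * b)) 1 = 0 := by rw [hXsa, h_one, map_zero]
  rw [hXder, map_add, LinearMap.add_apply, hBinv, hBinv, mul_one, mul_one, ← hXsa] at h_zero
  linarith
end

section
/- Let A be a commutative unital algebra over ℝ equipped with a symmetric ℝ-bilinear form ⟨·,·⟩ : A × A → ℝ that is invariant (⟨ab,c⟩ = ⟨a,bc⟩) and nondegenerate. Let {·,·} : A × A → A be a symmetric biderivation that admits a generating operator Δ₀ possessing an adjoint with respect to ⟨·,·⟩. Then there exists exactly one ℝ-linear operator Δ : A → A that generates {·,·}, is self-adjoint (⟨Δ(a),b⟩ = ⟨a,Δ(b)⟩ for all a,b), and satisfies Δ(1) = 0. -/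
section GeneratingOperator

variable {A : Type*} [CommRing A] [Algebra ℝ A]

/-- An operator `Δ` generates the bracket `br` if `br` measures the failure of `Δ` to be a
derivation, corrected by the constant term `Δ 1`. -/
def Generates (br : A →ₗ[ℝ] A →ₗ[ℝ] A) (Δ : A →ₗ[ℝ] A) : Prop :=
  ∀ a b : A, br a b = Δ (a * b) - a * Δ b - Δ a * b + a * b * Δ 1

namespace Generates

variable {br : A →ₗ[ℝ] A →ₗ[ℝ] A} {Δ Δ' : A →ₗ[ℝ] A}

/-- The operator generating a biderivation is a differential operator of order two. -/
theorem double_commutator (h : Generates br Δ)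
    (hder : ∀ a b c : A, br a (b * c) = br a b * c + b * br a c) (a b c : A) :
    Δ (a * (b * c)) - a * Δ (b * c) - b * Δ (a * c) + a * b * Δ c = br a b * c := by
  linear_combination hder a b c - h a (b * c) + b * h a c

/-- An adjoint of an operator generating a biderivation generates the same biderivation. -/
theorem adjoint {B : A →ₗ[ℝ] A →ₗ[ℝ] ℝ} (hinv : ∀ a b c : A, B (a * b) c = B a (b * c))
    (hsymm : ∀ a b : A, B a b = B b a) (hnd : ∀ a : A, (∀ b : A, B a b = 0) → a = 0)
    (h : Generates br Δ)
    (hder : ∀ a b c : A, br a (b * c) = br a b * c + b * br a c)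
    (hadj : ∀ a b : A, B (Δ a) b = B a (Δ' b)) : Generates br Δ' := by
  intro a b
  refine sub_eq_zero.mp (hnd _ fun c => ?_)
  have key := congrArg (fun x => B x 1) (h.double_commutator hder a b c)
  have e₁ : B (Δ (a * (b * c))) 1 = B c (a * b * Δ' 1) := by
    rw [hadj, ← hinv]; congr 2; ring
  have e₂ : B (a * Δ (b * c)) 1 = B c (b * Δ' a) := by
    rw [mul_comm, hinv, mul_one, hadj, mul_comm b c, hinv]
  have e₃ : B (b * Δ (a * c)) 1 = B c (a * Δ' b) := by
    rw [mul_comm, hinv, mul_one, hadj, mul_comm a c, hinv]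
  have e₄ : B (a * b * Δ c) 1 = B c (Δ' (a * b)) := by
    rw [mul_comm, hinv, mul_one, hadj]
  have e₅ : B (br a b * c) 1 = B c (br a b) := by
    rw [hinv, mul_one, hsymm]
  simp only [map_add, map_sub, LinearMap.add_apply, LinearMap.sub_apply, e₁, e₂, e₃, e₄, e₅]
    at key
  rw [hsymm, mul_comm (Δ' a) b]
  simp only [map_add, map_sub]
  linarith

/-- Averaging two generating operators and removing the constant term gives a generating
operator. -/
theorem average (h : Generates br Δ) (h' : Generates br Δ') :
    Generates br ((1 / 2 : ℝ) • (Δ + Δ' - LinearMap.mulLeft ℝ (Δ 1 + Δ' 1))) := by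
  intro a b
  have key : (2 : ℝ) • br a b = (Δ + Δ' - LinearMap.mulLeft ℝ (Δ 1 + Δ' 1)) (a * b)
      - a * (Δ + Δ' - LinearMap.mulLeft ℝ (Δ 1 + Δ' 1)) b
      - (Δ + Δ' - LinearMap.mulLeft ℝ (Δ 1 + Δ' 1)) a * b
      + a * b * (Δ + Δ' - LinearMap.mulLeft ℝ (Δ 1 + Δ' 1)) 1 := by
    simp only [LinearMap.sub_apply, LinearMap.add_apply, LinearMap.mulLeft_apply, two_smul]
    linear_combination h a b + h' a b
  simp only [LinearMap.smul_apply, mul_smul_comm, smul_mul_assoc, ← smul_sub, ← smul_add,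
    ← key, smul_smul]
  norm_num

/-- Two self-adjoint generating operators which kill the unit coincide. -/
theorem eq_of_selfAdjoint {B : A →ₗ[ℝ] A →ₗ[ℝ] ℝ}
    (hinv : ∀ a b c : A, B (a * b) c = B a (b * c))
    (hnd : ∀ a : A, (∀ b : A, B a b = 0) → a = 0)
    (h : Generates br Δ) (h' : Generates br Δ')
    (hself : ∀ a b : A, B (Δ a) b = B a (Δ b)) (hself' : ∀ a b : A, B (Δ' a) b = B a (Δ' b))
    (hone : Δ 1 = 0) (hone' : Δ' 1 = 0) : Δ = Δ' := by
  ext a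
  refine sub_eq_zero.mp (hnd _ fun b => ?_)
  have leib : Δ (a * b) - Δ' (a * b) = a * (Δ b - Δ' b) + (Δ a - Δ' a) * b := by
    linear_combination h' a b - h a b - a * b * hone + a * b * hone'
  have key := congrArg (fun x => B x 1) leib
  simp only [map_add, map_sub, LinearMap.add_apply, LinearMap.sub_apply, hinv, mul_one,
    hself, hself', hone, hone'] at key
  simp only [map_sub, LinearMap.sub_apply, hself, hself']
  linarith

end Generates

end GeneratingOperator

/-- Over a commutative unital `ℝ`-algebra `A` with an invariant
nondegenerate symmetric scalar product, any symmetric biderivation (bracket) which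
admits a generating operator possessing an adjoint has a *unique* generating operator
that is self-adjoint and kills the unit. -/
theorem unique_selfadjoint_constant_free_generating_operator
    {A : Type*} [CommRing A] [Algebra ℝ A] (B : A →ₗ[ℝ] A →ₗ[ℝ] ℝ)
    (hBsymm : ∀ a b : A, B a b = B b a)
    (hBinv : ∀ a b c : A, B (a * b) c = B a (b * c))
    (hBnd : ∀ a : A, (∀ b : A, B a b = 0) → a = 0)
    (br : A →ₗ[ℝ] A →ₗ[ℝ] A)
    (hbrsymm : ∀ a b : A, br a b = br b a)
    (hbrder : ∀ a b c : A, br a (b * c) = br a b * c + b * br a c)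
    (Δ₀ : A →ₗ[ℝ] A)
    (hΔ₀gen : ∀ a b : A, br a b = Δ₀ (a * b) - a * Δ₀ b - Δ₀ a * b + a * b * Δ₀ 1)
    (hΔ₀adj : ∃ Δ₀star : A →ₗ[ℝ] A, ∀ a b : A, B (Δ₀ a) b = B a (Δ₀star b)) :
    ∃! Δ : A →ₗ[ℝ] A,
      (∀ a b : A, br a b = Δ (a * b) - a * Δ b - Δ a * b + a * b * Δ 1) ∧
        (∀ a b : A, B (Δ a) b = B a (Δ b)) ∧ Δ 1 = 0 := by
  obtain ⟨Δ₀star, hadj⟩ := hΔ₀adj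
  have hgen : Generates br Δ₀ := hΔ₀gen
  have hgenstar : Generates br Δ₀star := hgen.adjoint hBinv hBsymm hBnd hbrder hadj
  refine existsUnique_of_exists_of_unique
    ⟨_, hgen.average hgenstar, fun a b => ?_, by simp⟩
    fun Δ Δ' ⟨hg, hs, h1⟩ ⟨hg', hs', h1'⟩ =>
      Generates.eq_of_selfAdjoint hBinv hBnd hg hg' hs hs' h1 h1'
  have hadj' : B (Δ₀star a) b = B a (Δ₀ b) := by rw [hBsymm, ← hadj, hBsymm]
  have hmul (f : A) : B (f * a) b = B a (f * b) := by rw [mul_comm, hBinv]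
  simp only [LinearMap.smul_apply, LinearMap.sub_apply, LinearMap.add_apply, map_smul,
    map_sub, map_add, LinearMap.mulLeft_apply, hmul, hadj, hadj']
  rw [add_comm (B a (Δ₀ b))]
end

section
/- Let n, m ∈ ℕ with (n : ℝ) − m + 1 ≠ 0, N = n + m, and let p : Fin N → ZMod 2 be a parity function with n even and m odd indices; write σ(i) = (−1)^{p(i)}, ε(i,j) = (−1)^{p(i)p(j)}. Let W be the real vector space of supersymmetric arrays A : Fin N × Fin N × Fin N → ℝ, i.e. those with A(i,j,k) = ε(i,j)·A(j,i,k) for all i,j,k. Define div(A)(i) := ∑_s σ(s)·A(i,s,s) and j(φ)(i,j,k) := φ(i)δ(j,k) + ε(i,j)φ(j)δ(i,k). Then j(φ) ∈ W for every φ : Fin N → ℝ, and W is the internal direct sum of the kernel of div restricted to W and the range of j; equivalently, every A ∈ W decomposes uniquely as A = A₀ + j(φ) with div(A₀) = 0, namely φ = div(A)/((n:ℝ)−m+1). -/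
/-- The real sign `σ(i) = (−1)^{p(i)}` attached to a parity function `p`. -/
noncomputable def sgn {N : ℕ} (p : Fin N → ZMod 2) (i : Fin N) : ℝ :=
  (-1 : ℝ) ^ (p i).val

/-- The real sign `ε(i,j) = (−1)^{p(i)p(j)}`. -/
noncomputable def eps {N : ℕ} (p : Fin N → ZMod 2) (i j : Fin N) : ℝ :=
  (-1 : ℝ) ^ ((p i).val * (p j).val)

/-- Kronecker delta. -/
noncomputable def kdelta {N : ℕ} (i j : Fin N) : ℝ := if i = j then 1 else 0

/-- The natural injection `j : V* → Σ²V*⊗V`, in components: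
`j(φ)(i,j,k) = φ(i)δ(j,k) + ε(i,j)φ(j)δ(i,k)`. -/
noncomputable def jmap {N : ℕ} (p : Fin N → ZMod 2) (φ : Fin N → ℝ)
    (i j k : Fin N) : ℝ :=
  φ i * kdelta j k + eps p i j * φ j * kdelta i k

/-- The supertrace-divergence `div(A)(i) = ∑ₛ σ(s)·A(i,s,s)`. -/
noncomputable def sdiv {N : ℕ} (p : Fin N → ZMod 2)
    (A : Fin N → Fin N → Fin N → ℝ) (i : Fin N) : ℝ :=
  ∑ s, sgn p s * A i s s

/-- An array is supersymmetric in its two lower indices if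
`A(i,j,k) = ε(i,j)·A(j,i,k)`. -/
def SuperSym {N : ℕ} (p : Fin N → ZMod 2) (A : Fin N → Fin N → Fin N → ℝ) : Prop :=
  ∀ i j k, A i j k = eps p i j * A j i k

theorem eps_comm {N : ℕ} (p : Fin N → ZMod 2) (i j : Fin N) : eps p i j = eps p j i := by
  rw [eps, eps, mul_comm]

theorem eps_mul_self {N : ℕ} (p : Fin N → ZMod 2) (i j : Fin N) :
    eps p i j * eps p i j = 1 := by
  rw [eps, ← mul_pow, neg_one_mul, neg_neg, one_pow]

theorem sgn_mul_eps_self {N : ℕ} (p : Fin N → ZMod 2) (i : Fin N) :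
    sgn p i * eps p i i = 1 := by
  rw [sgn, eps, ← pow_add, ← mul_one_add, add_comm 1]
  exact (Nat.even_mul_succ_self _).neg_one_pow

theorem sum_sgn {N : ℕ} (p : Fin N → ZMod 2) :
    ∑ s, sgn p s = ((Finset.univ.filter fun i => p i = 0).card : ℝ) -
      ((Finset.univ.filter fun i => p i = 1).card : ℝ) := by
  have h : ∀ a : ZMod 2, (-1 : ℝ) ^ a.val = (if a = 0 then 1 else 0) - if a = 1 then 1 else 0 := by
    intro a
    obtain rfl | rfl : a = 0 ∨ a = 1 := by revert a; decide
    · simp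
    · simp [ZMod.val_one]
  simp only [sgn, h, Finset.sum_sub_distrib, Finset.sum_boole]

theorem superSym_jmap {N : ℕ} (p : Fin N → ZMod 2) (φ : Fin N → ℝ) :
    SuperSym p (jmap p φ) := by
  intro i j k
  rw [jmap, jmap, eps_comm p j i]
  linear_combination (-φ i * kdelta j k) * eps_mul_self p i j

theorem SuperSym.sub {N : ℕ} {p : Fin N → ZMod 2} {A B : Fin N → Fin N → Fin N → ℝ}
    (hA : SuperSym p A) (hB : SuperSym p B) : SuperSym p (A - B) := by
  intro i j k
  simp only [Pi.sub_apply]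
  rw [hA i j k, hB i j k, mul_sub]

theorem sdiv_add {N : ℕ} (p : Fin N → ZMod 2) (A B : Fin N → Fin N → Fin N → ℝ) (i : Fin N) :
    sdiv p (A + B) i = sdiv p A i + sdiv p B i := by
  simp only [sdiv, Pi.add_apply, mul_add, Finset.sum_add_distrib]

/-- The composite of `j` and the divergence is multiplication by the superdimension plus one. -/
theorem sdiv_jmap {N : ℕ} (p : Fin N → ZMod 2) (φ : Fin N → ℝ) (i : Fin N) :
    sdiv p (jmap p φ) i = (∑ s, sgn p s + 1) * φ i := by
  have h : ∀ s, sgn p s * jmap p φ i s s =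
      sgn p s * φ i + if i = s then sgn p s * eps p i s * φ s else 0 := by
    intro s
    simp only [jmap, kdelta]
    split_ifs <;> ring
  simp only [sdiv, h, Finset.sum_add_distrib, Finset.sum_ite_eq, Finset.mem_univ, if_true,
    sgn_mul_eps_self, ← Finset.sum_mul]
  ring

/-- If `n − m + 1 ≠ 0` then `j(φ)` is supersymmetric for every `φ`,
and every supersymmetric array `A` decomposes uniquely as `A = A₀ + j(φ)` with `A₀`
supersymmetric and traceless; moreover in any such decomposition necessarily
`φ = div(A)/(n − m + 1)`. -/
theorem supersym_direct_sum_decomposition {n m : ℕ}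
    (hnm : (n : ℝ) - (m : ℝ) + 1 ≠ 0)
    (p : Fin (n + m) → ZMod 2)
    (hp0 : (Finset.univ.filter fun i => p i = 0).card = n)
    (hp1 : (Finset.univ.filter fun i => p i = 1).card = m) :
    (∀ φ : Fin (n + m) → ℝ, SuperSym p (jmap p φ)) ∧
      ∀ A : Fin (n + m) → Fin (n + m) → Fin (n + m) → ℝ, SuperSym p A →
        (∃! q : (Fin (n + m) → Fin (n + m) → Fin (n + m) → ℝ) × (Fin (n + m) → ℝ),
            SuperSym p q.1 ∧ (∀ i, sdiv p q.1 i = 0) ∧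
              ∀ i j k, A i j k = q.1 i j k + jmap p q.2 i j k) ∧
          ∀ (A₀ : Fin (n + m) → Fin (n + m) → Fin (n + m) → ℝ) (φ : Fin (n + m) → ℝ),
            SuperSym p A₀ → (∀ i, sdiv p A₀ i = 0) →
              (∀ i j k, A i j k = A₀ i j k + jmap p φ i j k) →
              φ = fun i => sdiv p A i / ((n : ℝ) - (m : ℝ) + 1) := by
  have hj : ∀ (φ : Fin (n + m) → ℝ) i, sdiv p (jmap p φ) i = ((n : ℝ) - m + 1) * φ i := by
    intro φ i
    rw [sdiv_jmap, sum_sgn, hp0, hp1]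
  refine ⟨superSym_jmap p, fun A hA => ?_⟩
  have key : ∀ (A₀ : Fin (n + m) → Fin (n + m) → Fin (n + m) → ℝ) (φ : Fin (n + m) → ℝ),
      (∀ i, sdiv p A₀ i = 0) → (∀ i j k, A i j k = A₀ i j k + jmap p φ i j k) →
      φ = fun i => sdiv p A i / ((n : ℝ) - (m : ℝ) + 1) := by
    intro A₀ φ h₀ h
    have hsum : A = A₀ + jmap p φ := by
      funext i j k
      exact h i j k
    funext i
    rw [eq_div_iff hnm, hsum, sdiv_add, h₀, hj]
    ring
  refine ⟨?_, fun A₀ φ _ => key A₀ φ⟩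
  set ψ : Fin (n + m) → ℝ := fun i => sdiv p A i / ((n : ℝ) - (m : ℝ) + 1) with hψ
  refine ⟨(A - jmap p ψ, ψ), ⟨hA.sub (superSym_jmap p ψ), fun i => ?_, fun i j k => ?_⟩, ?_⟩
  · have h := sdiv_add p (A - jmap p ψ) (jmap p ψ) i
    rw [sub_add_cancel, hj, hψ, mul_div_cancel₀ _ hnm] at h
    exact left_eq_add.mp (h.trans (add_comm _ _))
  · simp
  · rintro ⟨A₀, φ⟩ ⟨-, h₀, h⟩
    obtain rfl : φ = ψ := key A₀ φ h₀ h
    refine Prod.ext ?_ rfl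
    funext i j k
    exact eq_sub_of_add_eq (h i j k).symm
end
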